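/- arXiv:math/0702446 — 2 statements merged into one kernel-verified Lean document; each statement's English description precedes it below -/
import Mathlib

section
/- For every complex z with Re z > 0, f(z) = f(z+1) − 1/f(z+1), where f is the Bernstein transform of the fixed point measure μ; in particular f(z+1) ≠ 0 for Re z > 0. -/
open MeasureTheory Set

/-- The fixed point sequence. -/
noncomputable def fpSeq : ℕ → ℝ
  | 0 => 1
  | n + 1 => (-1 + Real.sqrt (1 + 4 * fpSeq n ^ 2)) / (2 * fpSeq n)

/-- The integrand `(1 - t^z)/(1 - t)`, extended continuously by the value `z` at `t = 1`. -/
noncomputable def bernKernel (z : ℂ) (t : ℝ) : ℂ :=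
  if t = 1 then z else (1 - (t : ℂ) ^ z) / (1 - (t : ℂ))

/-- The Bernstein transform of a measure `μ` on `[0,1]`. -/
noncomputable def bernTransform (μ : Measure ℝ) (z : ℂ) : ℂ :=
  ∫ t in Set.Icc (0:ℝ) 1, bernKernel z t ∂μ

lemma fpSeq_pos (n : ℕ) : 0 < fpSeq n := by
  induction n with
  | zero => simp [fpSeq]
  | succ n ih =>
    rw [fpSeq]
    have h : 1 < √(1 + 4 * fpSeq n ^ 2) := by
      rw [Real.lt_sqrt (by norm_num)]
      nlinarith [pow_pos ih 2]
    exact div_pos (by linarith) (by linarith)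

lemma fpSeq_succ_quadratic (n : ℕ) :
    fpSeq n * fpSeq (n + 1) ^ 2 + fpSeq (n + 1) = fpSeq n := by
  have hpos := fpSeq_pos n
  have hsq : √(1 + 4 * fpSeq n ^ 2) ^ 2 = 1 + 4 * fpSeq n ^ 2 := Real.sq_sqrt (by positivity)
  rw [fpSeq]
  generalize √(1 + 4 * fpSeq n ^ 2) = r at hsq ⊢
  field_simp
  linear_combination hsq

lemma sum_fpSeq_mul_fpSeq (n : ℕ) : (∑ k ∈ Finset.range (n + 1), fpSeq k) * fpSeq n = 1 := by
  induction n with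
  | zero => simp [fpSeq]
  | succ n ih =>
    have hpos := fpSeq_pos n
    have hq := fpSeq_succ_quadratic n
    rw [Finset.sum_range_succ]
    apply mul_left_cancel₀ hpos.ne'
    linear_combination hq + fpSeq (n + 1) * ih

/-- Finite measures on `[0, 1]` with the same moments integrate real continuous functions
equally. -/
lemma integral_eq_of_moments_eq {ρ₁ ρ₂ : Measure ℝ} [IsFiniteMeasure ρ₁] [IsFiniteMeasure ρ₂]
    (h₁ : ∀ᵐ x ∂ρ₁, x ∈ Icc (0 : ℝ) 1) (h₂ : ∀ᵐ x ∂ρ₂, x ∈ Icc (0 : ℝ) 1)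
    (hmom : ∀ n : ℕ, ∫ x, x ^ n ∂ρ₁ = ∫ x, x ^ n ∂ρ₂) {g : ℝ → ℝ} (hg : Continuous g) :
    ∫ x, g x ∂ρ₁ = ∫ x, g x ∂ρ₂ := by
  have integrable_of_continuous : ∀ {ρ : Measure ℝ} [IsFiniteMeasure ρ],
      (∀ᵐ x ∂ρ, x ∈ Icc (0 : ℝ) 1) → ∀ {f : ℝ → ℝ}, Continuous f → Integrable f ρ := by
    intro ρ _ hρ f hf
    obtain ⟨C, hC⟩ := isCompact_Icc.exists_bound_of_continuousOn (hf.continuousOn (s := Icc 0 1))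
    exact Integrable.of_bound hf.aestronglyMeasurable C (hρ.mono hC)
  have hpoly : ∀ p : Polynomial ℝ, ∫ x, p.eval x ∂ρ₁ = ∫ x, p.eval x ∂ρ₂ := by
    intro p
    simp only [Polynomial.eval_eq_sum_range]
    rw [integral_finsetSum _ fun i _ ↦ integrable_of_continuous h₁ (by fun_prop),
      integral_finsetSum _ fun i _ ↦ integrable_of_continuous h₂ (by fun_prop)]
    simp only [integral_const_mul, hmom]
  have approx : ∀ {ρ : Measure ℝ} [IsFiniteMeasure ρ], (∀ᵐ x ∂ρ, x ∈ Icc (0 : ℝ) 1) →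
      ∀ (p : Polynomial ℝ) (ε : ℝ), (∀ x ∈ Icc (0 : ℝ) 1, |p.eval x - g x| < ε) →
      |∫ x, p.eval x ∂ρ - ∫ x, g x ∂ρ| ≤ ε * ρ.real univ := by
    intro ρ _ hρ p ε hp
    rw [← integral_sub (integrable_of_continuous hρ p.continuous) (integrable_of_continuous hρ hg)]
    have hbound : ∀ᵐ x ∂ρ, ‖p.eval x - g x‖ ≤ ε := hρ.mono fun x hx ↦ (hp x hx).le
    exact norm_integral_le_of_norm_le_const hbound
  refine eq_of_forall_dist_le fun ε hε ↦ ?_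
  set M := ρ₁.real univ + ρ₂.real univ + 1 with hM
  have hMpos : 0 < M := by positivity
  obtain ⟨p, hp⟩ := exists_polynomial_near_of_continuousOn 0 1 g hg.continuousOn (ε / M)
    (by positivity)
  have e₁ := approx h₁ p _ hp
  have e₂ := approx h₂ p _ hp
  rw [hpoly p] at e₁
  have hsum : ε / M * ρ₁.real univ + ε / M * ρ₂.real univ ≤ ε := by
    have : ε / M * M = ε := by field_simp
    have : 0 < ε / M := by positivity
    nlinarith
  rw [Real.dist_eq]
  rw [abs_le] at *
  constructor <;> linarith [e₁.1, e₁.2, e₂.1, e₂.2]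

/-- Finite measures on `[0, 1]` with the same moments are equal. -/
lemma measure_ext_of_moments_eq {ρ₁ ρ₂ : Measure ℝ} [IsFiniteMeasure ρ₁] [IsFiniteMeasure ρ₂]
    (h₁ : ∀ᵐ x ∂ρ₁, x ∈ Icc (0 : ℝ) 1) (h₂ : ∀ᵐ x ∂ρ₂, x ∈ Icc (0 : ℝ) 1)
    (hmom : ∀ n : ℕ, ∫ x, x ^ n ∂ρ₁ = ∫ x, x ^ n ∂ρ₂) : ρ₁ = ρ₂ :=
  ext_of_forall_integral_eq_of_IsFiniteMeasure fun f ↦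
    integral_eq_of_moments_eq h₁ h₂ hmom f.continuous

lemma add_one_ne_zero_of_re_nonneg {z : ℂ} (hz : 0 ≤ z.re) : z + 1 ≠ 0 := fun h ↦ by
  have := congrArg Complex.re h
  simp at this
  linarith

/-- The kernel at `z + 1` is `z + 1` times the mean of `s ^ z` over `s` uniform on `[t, 1]`. -/
lemma bernKernel_add_one_eq_integral {z : ℂ} (hz : 0 ≤ z.re) (t : ℝ) :
    bernKernel (z + 1) t = (z + 1) * ∫ v in (0 : ℝ)..1, ((1 - (1 - t) * v : ℝ) : ℂ) ^ z := by
  have hz1 := add_one_ne_zero_of_re_nonneg hz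
  rw [bernKernel]
  split_ifs with ht
  · simp [ht]
  · have ht' : 1 - t ≠ 0 := sub_ne_zero.2 (Ne.symm ht)
    have htc : (1 : ℂ) - t ≠ 0 := by exact_mod_cast ht'
    rw [intervalIntegral.integral_comp_sub_mul (fun s : ℝ ↦ (s : ℂ) ^ z) ht',
      integral_cpow (Or.inl (by linarith))]
    simp
    field_simp

lemma bernKernel_add_one {z : ℂ} (hz : 0 ≤ z.re) (t : ℝ) :
    bernKernel (z + 1) t = bernKernel z t + (t : ℂ) ^ z := by
  have hz1 := add_one_ne_zero_of_re_nonneg hz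
  rcases eq_or_ne t 1 with rfl | ht
  · simp [bernKernel]
  have htc : (1 : ℂ) - t ≠ 0 := sub_ne_zero.2 (by exact_mod_cast ht.symm)
  simp only [bernKernel, if_neg ht]
  rcases eq_or_ne t 0 with rfl | ht0
  · simp [Complex.zero_cpow hz1]
  · rw [Complex.cpow_add _ _ (by exact_mod_cast ht0), Complex.cpow_one]
    field_simp
    ring

lemma measurable_ofReal_cpow (z : ℂ) : Measurable fun s : ℝ ↦ (s : ℂ) ^ z :=
  Complex.measurable_ofReal.pow_const z

lemma norm_ofReal_cpow_le_one {s : ℝ} (hs : s ∈ Icc (0 : ℝ) 1) {z : ℂ} (hz : 0 ≤ z.re) :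
    ‖(s : ℂ) ^ z‖ ≤ 1 := by
  rcases hs.1.eq_or_lt with rfl | hpos
  · rcases eq_or_ne z 0 with rfl | hz0
    · simp
    · simp [Complex.zero_cpow hz0]
  · rw [Complex.norm_cpow_eq_rpow_re_of_pos hpos]
    exact Real.rpow_le_one hpos.le hs.2 hz

lemma one_sub_mul_mem_Icc {t v : ℝ} (ht : t ∈ Icc (0 : ℝ) 1) (hv : v ∈ Icc (0 : ℝ) 1) :
    1 - (1 - t) * v ∈ Icc (0 : ℝ) 1 := by
  obtain ⟨ht0, ht1⟩ := ht
  obtain ⟨hv0, hv1⟩ := hv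
  constructor <;> nlinarith

lemma ae_mem_prod_uniform {μ : Measure ℝ} (hμ : ∀ᵐ t ∂μ, t ∈ Icc (0 : ℝ) 1) :
    ∀ᵐ p ∂μ.prod (volume.restrict (Ioc (0 : ℝ) 1)), 1 - (1 - p.1) * p.2 ∈ Icc (0 : ℝ) 1 := by
  have hv : ∀ᵐ v ∂volume.restrict (Ioc (0 : ℝ) 1), v ∈ Ioc (0 : ℝ) 1 :=
    ae_restrict_mem measurableSet_Ioc
  filter_upwards [Measure.quasiMeasurePreserving_fst.ae hμ,
    Measure.quasiMeasurePreserving_snd.ae hv] with p h₁ h₂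
  exact one_sub_mul_mem_Icc h₁ (Ioc_subset_Icc_self h₂)

lemma bernTransform_eq_integral {μ : Measure ℝ} (hμ : ∀ᵐ t ∂μ, t ∈ Icc (0 : ℝ) 1)
    (z : ℂ) :
    bernTransform μ z = ∫ t, bernKernel z t ∂μ := by
  rw [bernTransform, Measure.restrict_eq_self_of_ae_mem hμ]

section Transform

variable {μ : Measure ℝ} [IsProbabilityMeasure μ]

lemma integrable_cpow_prod_uniform (hμ : ∀ᵐ t ∂μ, t ∈ Icc (0 : ℝ) 1) {z : ℂ} (hz : 0 ≤ z.re) :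
    Integrable (fun p : ℝ × ℝ ↦ ((1 - (1 - p.1) * p.2 : ℝ) : ℂ) ^ z)
      (μ.prod (volume.restrict (Ioc (0 : ℝ) 1))) :=
  Integrable.of_bound ((measurable_ofReal_cpow z).comp (by fun_prop)).aestronglyMeasurable 1
    ((ae_mem_prod_uniform hμ).mono fun _ hp ↦ norm_ofReal_cpow_le_one hp hz)

lemma integrable_bernKernel_add_one (hμ : ∀ᵐ t ∂μ, t ∈ Icc (0 : ℝ) 1) {z : ℂ}
    (hz : 0 ≤ z.re) : Integrable (bernKernel (z + 1)) μ := by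
  rw [funext (bernKernel_add_one_eq_integral hz)]
  simp only [intervalIntegral.integral_of_le zero_le_one]
  exact (integrable_cpow_prod_uniform hμ hz).integral_prod_left.const_mul _

lemma integrable_ofReal_cpow (hμ : ∀ᵐ t ∂μ, t ∈ Icc (0 : ℝ) 1) {z : ℂ} (hz : 0 ≤ z.re) :
    Integrable (fun t : ℝ ↦ (t : ℂ) ^ z) μ :=
  Integrable.of_bound (measurable_ofReal_cpow z).aestronglyMeasurable 1
    (hμ.mono fun _ ht ↦ norm_ofReal_cpow_le_one ht hz)

lemma bernTransform_add_one (hμ : ∀ᵐ t ∂μ, t ∈ Icc (0 : ℝ) 1) {z : ℂ} (hz : 0 ≤ z.re) :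
    bernTransform μ (z + 1) = bernTransform μ z + ∫ t, (t : ℂ) ^ z ∂μ := by
  have hpow := integrable_ofReal_cpow hμ hz
  have hint : Integrable (bernKernel z) μ := by
    refine ((integrable_bernKernel_add_one hμ hz).sub hpow).congr (.of_forall fun t ↦ ?_)
    simp [bernKernel_add_one hz]
  simp only [bernTransform_eq_integral hμ, bernKernel_add_one hz]
  exact integral_add hint hpow

/-- If `u, t` have law `μ` and `v` is uniform on `(0, 1]`, all independent, then the Mellin
transform of `u * (1 - (1 - t) * v)` factors through the Bernstein transform. -/
lemma integral_cpow_prod_eq (hμ : ∀ᵐ t ∂μ, t ∈ Icc (0 : ℝ) 1) {z : ℂ} (hz : 0 ≤ z.re) :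
    (z + 1) * ∫ p, ((p.1 * (1 - (1 - p.2.1) * p.2.2) : ℝ) : ℂ) ^ z
        ∂μ.prod (μ.prod (volume.restrict (Ioc (0 : ℝ) 1))) =
      (∫ u, (u : ℂ) ^ z ∂μ) * bernTransform μ (z + 1) := by
  have hfactor : ∫ p, ((p.1 * (1 - (1 - p.2.1) * p.2.2) : ℝ) : ℂ) ^ z
        ∂μ.prod (μ.prod (volume.restrict (Ioc (0 : ℝ) 1))) =
      ∫ p, (p.1 : ℂ) ^ z * ((1 - (1 - p.2.1) * p.2.2 : ℝ) : ℂ) ^ z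
        ∂μ.prod (μ.prod (volume.restrict (Ioc (0 : ℝ) 1))) := by
    apply integral_congr_ae
    filter_upwards [Measure.quasiMeasurePreserving_fst.ae hμ,
      Measure.quasiMeasurePreserving_snd.ae (ae_mem_prod_uniform hμ)] with p h₁ h₂
    rw [Complex.ofReal_mul, Complex.mul_cpow_ofReal_nonneg h₁.1 h₂.1]
  rw [hfactor, integral_prod_mul (fun u : ℝ ↦ (u : ℂ) ^ z)
    (fun p : ℝ × ℝ ↦ ((1 - (1 - p.1) * p.2 : ℝ) : ℂ) ^ z),
    integral_prod _ (integrable_cpow_prod_uniform hμ hz), bernTransform_eq_integral hμ,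
    funext (bernKernel_add_one_eq_integral hz), integral_const_mul]
  simp only [intervalIntegral.integral_of_le zero_le_one]
  ring

lemma integral_ofReal_cpow_natCast (ν : Measure ℝ) (n : ℕ) :
    ∫ t, (t : ℂ) ^ (n : ℂ) ∂ν = ((∫ t, t ^ n ∂ν : ℝ) : ℂ) := by
  rw [← integral_complex_ofReal]
  simp

lemma bernTransform_natCast (hμ : ∀ᵐ t ∂μ, t ∈ Icc (0 : ℝ) 1) (n : ℕ) :
    bernTransform μ n = ((∑ k ∈ Finset.range n, ∫ t, t ^ k ∂μ : ℝ) : ℂ) := by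
  induction n with
  | zero =>
    have h : ∀ t, bernKernel 0 t = 0 := fun t ↦ by simp [bernKernel]
    simp [bernTransform, h]
  | succ n ih =>
    rw [Nat.cast_succ, bernTransform_add_one hμ (by simp), ih, integral_ofReal_cpow_natCast,
      Finset.sum_range_succ, Complex.ofReal_add]

/-- For a measure on `[0, 1]` whose moments are the fixed point sequence, the Mellin transform is
the reciprocal of the shifted Bernstein transform. -/
lemma integral_cpow_mul_bernTransform (hμ : ∀ᵐ t ∂μ, t ∈ Icc (0 : ℝ) 1)
    (hmom : ∀ n : ℕ, ∫ t, t ^ n ∂μ = fpSeq n) {z : ℂ} (hz : 0 ≤ z.re) :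
    (∫ u, (u : ℂ) ^ z ∂μ) * bernTransform μ (z + 1) = 1 := by
  set P := μ.prod (μ.prod (volume.restrict (Ioc (0 : ℝ) 1))) with hP
  set Y : ℝ × ℝ × ℝ → ℝ := fun p ↦ p.1 * (1 - (1 - p.2.1) * p.2.2) with hY
  have hYm : Measurable Y := by fun_prop
  have hmap : ∀ w : ℂ, ∫ y, (y : ℂ) ^ w ∂P.map Y = ∫ p, (Y p : ℂ) ^ w ∂P := fun w ↦
    integral_map hYm.aemeasurable (measurable_ofReal_cpow w).aestronglyMeasurable
  have huniform : ∀ w : ℂ, 0 ≤ w.re →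
      (w + 1) * ∫ y in Ioc (0 : ℝ) 1, (y : ℂ) ^ w = 1 := by
    intro w hw
    have hw1 := add_one_ne_zero_of_re_nonneg hw
    rw [← intervalIntegral.integral_of_le zero_le_one, integral_cpow (Or.inl (by linarith))]
    simp [Complex.zero_cpow hw1, hw1]
  have hlaw : P.map Y = volume.restrict (Ioc (0 : ℝ) 1) := by
    apply measure_ext_of_moments_eq
    · refine (ae_map_iff hYm.aemeasurable measurableSet_Icc).2 ?_
      filter_upwards [Measure.quasiMeasurePreserving_fst.ae hμ,
        Measure.quasiMeasurePreserving_snd.ae (ae_mem_prod_uniform hμ)] with p h₁ h₂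
      exact ⟨mul_nonneg h₁.1 h₂.1, mul_le_one₀ h₁.2 h₂.1 h₂.2⟩
    · exact (ae_restrict_mem measurableSet_Ioc).mono fun _ hv ↦ Ioc_subset_Icc_self hv
    · intro n
      have hn : ((n : ℂ) + 1) ≠ 0 := by exact_mod_cast n.succ_ne_zero
      rw [← Complex.ofReal_inj, ← integral_ofReal_cpow_natCast, ← integral_ofReal_cpow_natCast,
        hmap]
      apply mul_left_cancel₀ hn
      rw [huniform n (by simp), integral_cpow_prod_eq hμ (by simp), integral_ofReal_cpow_natCast,
        ← Nat.cast_succ, bernTransform_natCast hμ]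
      simp only [hmom]
      rw [mul_comm]
      exact_mod_cast sum_fpSeq_mul_fpSeq n
  rw [← integral_cpow_prod_eq hμ hz, ← hmap, hlaw, huniform z hz]

end Transform

theorem stmt_2 (μ : Measure ℝ) [IsProbabilityMeasure μ]
    (hsupp : μ (Set.Icc (0:ℝ) 1)ᶜ = 0) (h0 : μ {0} = 0)
    (hmom : ∀ n : ℕ, ∫ t in Set.Icc (0:ℝ) 1, t ^ n ∂μ = fpSeq n)
    (z : ℂ) (hz : 0 < z.re) :
    bernTransform μ (z + 1) ≠ 0 ∧
      bernTransform μ z = bernTransform μ (z + 1) - 1 / bernTransform μ (z + 1) := by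
  have hμ : ∀ᵐ t ∂μ, t ∈ Icc (0 : ℝ) 1 := hsupp
  rw [Measure.restrict_eq_self_of_ae_mem hμ] at hmom
  have hprod := integral_cpow_mul_bernTransform hμ hmom hz.le
  refine ⟨right_ne_zero_of_mul_eq_one hprod, ?_⟩
  rw [← eq_one_div_of_mul_eq_one_left hprod, bernTransform_add_one hμ hz.le, add_sub_cancel_right]
end

section
/- The sequence (λ_n)_{n≥0} is strictly increasing with λ_n → ∞; the sequence of ratios (λ_{n+1}/λ_n)_{n≥1} is nonincreasing and converges to 1. -/
open Filter

/-- The sequence `λ₀ = 0`, `λ_{n+1} = (λₙ + √(λₙ² + 4))/2`. -/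
noncomputable def lamSeq : ℕ → ℝ
  | 0 => 0
  | n + 1 => (lamSeq n + Real.sqrt (lamSeq n ^ 2 + 4)) / 2

theorem lamSeq_nonneg (n : ℕ) : 0 ≤ lamSeq n := by
  induction n with
  | zero => simp [lamSeq]
  | succ n ih => rw [lamSeq]; positivity

theorem lamSeq_succ_pos (n : ℕ) : 0 < lamSeq (n + 1) := by
  have := lamSeq_nonneg n
  rw [lamSeq]
  positivity

theorem lamSeq_succ_sq (n : ℕ) : lamSeq (n + 1) ^ 2 = lamSeq n * lamSeq (n + 1) + 1 := by
  have h : Real.sqrt (lamSeq n ^ 2 + 4) ^ 2 = lamSeq n ^ 2 + 4 := Real.sq_sqrt (by positivity)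
  rw [lamSeq]
  linear_combination h / 4

theorem lamSeq_strictMono : StrictMono lamSeq :=
  strictMono_nat_of_lt_succ fun n => by
    nlinarith [lamSeq_succ_pos n, lamSeq_succ_sq n]

theorem natCast_le_lamSeq_sq (n : ℕ) : (n : ℝ) ≤ lamSeq n ^ 2 := by
  induction n with
  | zero => simp [lamSeq]
  | succ n ih =>
    push_cast
    nlinarith [lamSeq_succ_sq n, lamSeq_nonneg n, lamSeq_strictMono n.lt_succ_self]

theorem tendsto_lamSeq_atTop : Tendsto lamSeq atTop atTop :=
  tendsto_atTop_mono (fun n => Real.sqrt_le_iff.2 ⟨lamSeq_nonneg n, natCast_le_lamSeq_sq n⟩)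
    (Real.tendsto_sqrt_atTop.comp tendsto_natCast_atTop_atTop)

theorem lamSeq_mul_le_sq (n : ℕ) : lamSeq (n + 2) * lamSeq n ≤ lamSeq (n + 1) ^ 2 := by
  have hpos := lamSeq_succ_pos (n + 1)
  have hle : lamSeq n ≤ lamSeq (n + 2) := lamSeq_strictMono.monotone (by lia)
  refine le_of_mul_le_mul_left ?_ hpos
  linear_combination hle + lamSeq n * lamSeq_succ_sq (n + 1) -
    lamSeq (n + 2) * lamSeq_succ_sq n

theorem lamSeq_succ_div {n : ℕ} (hn : 1 ≤ n) :
    lamSeq (n + 1) / lamSeq n = 1 + (lamSeq n * lamSeq (n + 1))⁻¹ := by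
  obtain ⟨m, rfl⟩ := Nat.exists_eq_add_of_le' hn
  have h₀ := (lamSeq_succ_pos m).ne'
  have h₁ := (lamSeq_succ_pos (m + 1)).ne'
  field_simp
  linear_combination lamSeq_succ_sq (m + 1)

theorem tendsto_lamSeq_succ_div :
    Tendsto (fun n : ℕ => lamSeq (n + 1) / lamSeq n) atTop (nhds 1) := by
  have hprod : Tendsto (fun n => lamSeq n * lamSeq (n + 1)) atTop atTop :=
    tendsto_lamSeq_atTop.atTop_mul_atTop₀ (tendsto_lamSeq_atTop.comp (tendsto_add_atTop_nat 1))
  have hlim := hprod.inv_tendsto_atTop.const_add 1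
  rw [add_zero] at hlim
  refine hlim.congr' ?_
  filter_upwards [eventually_ge_atTop 1] with n hn
  exact (lamSeq_succ_div hn).symm

theorem stmt_11 :
    StrictMono lamSeq ∧
    Tendsto lamSeq atTop atTop ∧
    (∀ n : ℕ, 1 ≤ n →
      lamSeq (n + 2) / lamSeq (n + 1) ≤ lamSeq (n + 1) / lamSeq n) ∧
    Tendsto (fun n : ℕ => lamSeq (n + 1) / lamSeq n) atTop (nhds 1) := by
  refine ⟨lamSeq_strictMono, tendsto_lamSeq_atTop, fun n hn => ?_, tendsto_lamSeq_succ_div⟩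
  obtain ⟨m, rfl⟩ := Nat.exists_eq_add_of_le' hn
  rw [div_le_div_iff₀ (lamSeq_succ_pos _) (lamSeq_succ_pos m), ← sq]
  exact lamSeq_mul_le_sq _
end
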